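/- Assume ξ_n^{s,t} ≠ 0, ξ_{n−1}^{s,t} ≠ 0, τ_{n−1}^{s+1,t} ≠ 0 and τ_n^{s+1,t} ≠ 0. Then for every n ≥ 1 the polynomial identity Q_n^{s,t}(x) = x·P_{n−1}^{s+1,t}(x) − (ξ_{n−1}^{s,t}τ_n^{s+1,t}/(ξ_n^{s,t}τ_{n−1}^{s+1,t}))·Q_{n−1}^{s,t}(x) holds. -/

import Mathlib

open MeasureTheory

/-- Bimoments `m_{i,j}^{s,t}` of the Cauchy-Jacobi weight. -/
noncomputable def mom (s t i j : ℕ) : ℝ :=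
  ∫ p in (Set.Ioo (0:ℝ) 1 ×ˢ Set.Ioo (0:ℝ) 1),
    (p.1 ^ (s + i) * p.2 ^ (s + j) / (p.1 + p.2)) *
      ((1 - p.1) / (1 + p.1)) ^ t * ((1 - p.2) / (1 + p.2)) ^ t

/-- Single moments `φ_i^{s,t} = L_{s,t}(x^i)`. -/
noncomputable def phi (s t i : ℕ) : ℝ :=
  Real.sqrt 2 * ∫ x in Set.Ioo (0:ℝ) 1,
    (x ^ (s + i) / (1 + x)) * ((1 - x) / (1 + x)) ^ t

/-- Single moments `m_i^{s,t}`. -/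
noncomputable def momS (s t i : ℕ) : ℝ :=
  ∫ x in Set.Ioo (0:ℝ) 1, x ^ (s + i) * ((1 - x) / (1 + x)) ^ t

/-- `τ_n^{s,t} = det(m_{i,j}^{s,t})_{i,j=0}^{n-1}` (with `τ_0^{s,t} = 1`). -/
noncomputable def tau (s t n : ℕ) : ℝ :=
  Matrix.det (Matrix.of fun i j : Fin n => mom s t i j)

/-- `ξ_n^{s,t} = det(m_{i,j+1}^{s,t})_{i,j=0}^{n-1}` (with `ξ_0^{s,t} = 1`). -/
noncomputable def xi (s t n : ℕ) : ℝ :=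
  Matrix.det (Matrix.of fun i j : Fin n => mom s t i ((j : ℕ) + 1))

/-- `σ_n^{s,t}`: determinant of the `(n+1)×(n+1)` matrix with first `n` columns the
bimoments and last column `(φ_0^{s,t},…,φ_n^{s,t})`. -/
noncomputable def sig (s t n : ℕ) : ℝ :=
  Matrix.det (Matrix.of fun i j : Fin (n + 1) =>
    if (j : ℕ) < n then mom s t i j else phi s t i)

/-- `ψ_n^{s,t}`: like `σ_n^{s,t}` but with shifted bimoments `m_{i,j+1}^{s,t}`. -/
noncomputable def psi (s t n : ℕ) : ℝ :=
  Matrix.det (Matrix.of fun i j : Fin (n + 1) =>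
    if (j : ℕ) < n then mom s t i ((j : ℕ) + 1) else phi s t i)

/-- `σ̃_n^{s,t}`: determinant of the `(n+1)×(n+1)` matrix with first `n` columns the
bimoments and last column the single moments `(m_0^{s,t},…,m_n^{s,t})`. -/
noncomputable def sigT (s t n : ℕ) : ℝ :=
  Matrix.det (Matrix.of fun i j : Fin (n + 1) =>
    if (j : ℕ) < n then mom s t i j else momS s t i)

/-- `τ̃_n^{s,t}`: determinant of the `n×n` matrix whose rows are the bimoment rows
`i = 0,…,n−2,n`. -/
noncomputable def tauT (s t n : ℕ) : ℝ :=
  Matrix.det (Matrix.of fun i j : Fin n =>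
    mom s t (if (i : ℕ) < n - 1 then (i : ℕ) else n) j)

/-- The monic Cauchy-Jacobi orthogonal polynomial `P_n^{s,t}` (as a real function). -/
noncomputable def P (s t n : ℕ) (x : ℝ) : ℝ :=
  (1 / tau s t n) * Matrix.det (Matrix.of fun i j : Fin (n + 1) =>
    if (j : ℕ) < n then mom s t i j else x ^ (i : ℕ))

/-- The adjacent monic polynomial `Q_n^{s,t}` (as a real function). -/
noncomputable def Q (s t n : ℕ) (x : ℝ) : ℝ :=
  (1 / xi s t n) * Matrix.det (Matrix.of fun i j : Fin (n + 1) =>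
    if (j : ℕ) < n then mom s t i ((j : ℕ) + 1) else x ^ (i : ℕ))

/-- The auxiliary monic polynomial `R_n^{s,t}` (as a real function): first column
`(φ_0,…,φ_n)`, next `n−1` columns the bimoments `m_{i,j}` for `j = 0,…,n−2`,
last column `(1,x,…,x^n)`, normalized by `(−1)^{n−1}/σ_{n−1}^{s,t}`. -/
noncomputable def R (s t n : ℕ) (x : ℝ) : ℝ :=
  ((-1 : ℝ) ^ (n - 1) / sig s t (n - 1)) *
    Matrix.det (Matrix.of fun i j : Fin (n + 1) =>
      if (j : ℕ) = 0 then phi s t i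
      else if (j : ℕ) < n then mom s t i ((j : ℕ) - 1) else x ^ (i : ℕ))

/-- The two-parameter deformed Cauchy inner product `⟨f,g⟩_{s,t}` on real functions. -/
noncomputable def innerF (s t : ℕ) (f g : ℝ → ℝ) : ℝ :=
  ∫ p in (Set.Ioo (0:ℝ) 1 ×ˢ Set.Ioo (0:ℝ) 1),
    (p.1 ^ s * p.2 ^ s / (p.1 + p.2)) * f p.1 * g p.2 *
      ((1 - p.1) / (1 + p.1)) ^ t * ((1 - p.2) / (1 + p.2)) ^ t

/-- The two-parameter deformed Cauchy inner product on real polynomials. -/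
noncomputable def innerP (s t : ℕ) (f g : Polynomial ℝ) : ℝ :=
  innerF s t (fun x => f.eval x) (fun y => g.eval y)

/-- The linear functional `L_{s,t}` on real functions. -/
noncomputable def LF (s t : ℕ) (f : ℝ → ℝ) : ℝ :=
  Real.sqrt 2 * ∫ x in Set.Ioo (0:ℝ) 1,
    (x ^ s / (1 + x)) * f x * ((1 - x) / (1 + x)) ^ t

/-- The linear functional `L_{s,t}` on real polynomials. -/
noncomputable def LP (s t : ℕ) (f : Polynomial ℝ) : ℝ := LF s t (fun x => f.eval x)

/-- The matrix whose first `n` columns are those of the array `a` and whose last column is `v`. -/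
def bordered (a : ℕ → ℕ → ℝ) (n : ℕ) (v : ℕ → ℝ) : Matrix (Fin (n + 1)) (Fin (n + 1)) ℝ :=
  Matrix.of fun i j => if (j : ℕ) < n then a i j else v i

/-- The leading `n × n` minor of the array `a`. -/
def leadingMinor (a : ℕ → ℕ → ℝ) (n : ℕ) : ℝ :=
  Matrix.det (Matrix.of fun i j : Fin n => a i j)

theorem det_bordered_eq_sum (a : ℕ → ℕ → ℝ) (n : ℕ) (v : ℕ → ℝ) :
    (bordered a n v).det = ∑ i : Fin (n + 1), v i *
      ((-1) ^ ((i : ℕ) + n) * Matrix.det (Matrix.of fun k l : Fin n => a (i.succAbove k) l)) := by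
  rw [Matrix.det_succ_column _ (Fin.last n)]
  refine Finset.sum_congr rfl fun i _ => ?_
  have h : (bordered a n v).submatrix i.succAbove (Fin.last n).succAbove =
      Matrix.of fun k l : Fin n => a (i.succAbove k) l := by
    ext k l
    simp [bordered]
  rw [h]
  simp [bordered]
  ring

theorem det_bordered_column (a : ℕ → ℕ → ℝ) (n j : ℕ) (hj : j < n) :
    (bordered a n fun i => a i j).det = 0 := by
  refine Matrix.det_zero_of_column_eq (i := ⟨j, by omega⟩) (j := Fin.last n) ?_ fun i => ?_
  · simp [Fin.ext_iff]
    omega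
  · simp [bordered, hj]

theorem det_bordered_next_column (a : ℕ → ℕ → ℝ) (n : ℕ) :
    (bordered a n fun i => a i n).det = leadingMinor a (n + 1) := by
  unfold leadingMinor
  congr 1
  ext i j
  simp only [bordered, Matrix.of_apply]
  split_ifs with h
  · rfl
  · rw [show (j : ℕ) = n by omega]

theorem det_bordered_single_zero (a : ℕ → ℕ → ℝ) (n : ℕ) :
    (bordered a n fun i => if i = 0 then 1 else 0).det =
      (-1) ^ n * leadingMinor (fun i j => a (i + 1) j) n := by
  rw [det_bordered_eq_sum, Fin.sum_univ_succ]
  simp [leadingMinor]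

/-- A case of the Desnanot–Jacobi determinant identity. -/
theorem det_bordered_mul_leadingMinor (a : ℕ → ℕ → ℝ) (k : ℕ)
    (h : leadingMinor (fun i j => a (i + 1) j) (k + 1) ≠ 0) (v : ℕ → ℝ) :
    (bordered a (k + 1) v).det * leadingMinor (fun i j => a (i + 1) j) k =
      leadingMinor a (k + 1) * (bordered (fun i j => a (i + 1) j) k fun i => v (i + 1)).det -
        leadingMinor (fun i j => a (i + 1) j) (k + 1) * (bordered a k v).det := by
  set b : ℕ → ℕ → ℝ := fun i j => a (i + 1) j
  obtain ⟨f, hf⟩ : ∃ f : Fin (k + 2) → ℝ, ∀ w : ℕ → ℝ,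
      (bordered a (k + 1) w).det * leadingMinor b k -
        leadingMinor a (k + 1) * (bordered b k fun i => w (i + 1)).det +
        leadingMinor b (k + 1) * (bordered a k w).det = ∑ i, f i * w i := by
    let c (a : ℕ → ℕ → ℝ) (n : ℕ) (i : Fin (n + 1)) : ℝ :=
      (-1) ^ ((i : ℕ) + n) * Matrix.det (Matrix.of fun k l : Fin n => a (i.succAbove k) l)
    refine ⟨fun i => c a (k + 1) i * leadingMinor b k -
      leadingMinor a (k + 1) * Fin.cases (motive := fun _ => ℝ) 0 (fun i => c b k i) i +
      leadingMinor b (k + 1) * Fin.lastCases (motive := fun _ => ℝ) 0 (fun i => c a k i) i,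
      fun w => ?_⟩
    simp only [add_mul, sub_mul, Finset.sum_add_distrib, Finset.sum_sub_distrib]
    congr 1
    · congr 1
      · rw [det_bordered_eq_sum, Finset.sum_mul]
        exact Finset.sum_congr rfl fun i _ => by simp only [c]; ring
      · rw [det_bordered_eq_sum, Fin.sum_univ_succ (n := k + 1), Finset.mul_sum]
        simp only [Fin.cases_zero, mul_zero, zero_mul, zero_add, Fin.cases_succ, Fin.val_succ]
        exact Finset.sum_congr rfl fun i _ => by simp only [c]; ring
    · rw [det_bordered_eq_sum, Fin.sum_univ_castSucc (n := k + 1), Finset.mul_sum]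
      simp only [Fin.lastCases_last, mul_zero, zero_mul, add_zero, Fin.lastCases_castSucc,
        Fin.val_castSucc]
      exact Finset.sum_congr rfl fun i _ => by simp only [c]; ring
  let e : ℕ → ℝ := fun i => if i = 0 then 1 else 0
  have hdet : (bordered a (k + 1) e).det ≠ 0 := by
    rw [det_bordered_single_zero]
    exact mul_ne_zero (pow_ne_zero _ (by norm_num)) h
  have hker : Matrix.vecMul f (bordered a (k + 1) e) = 0 := by
    ext j
    have key (w : ℕ → ℝ) (hw : ∀ i : Fin (k + 2), bordered a (k + 1) e i j = w i) :
        Matrix.vecMul f (bordered a (k + 1) e) j =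
          (bordered a (k + 1) w).det * leadingMinor b k -
          leadingMinor a (k + 1) * (bordered b k fun i => w (i + 1)).det +
          leadingMinor b (k + 1) * (bordered a k w).det := by
      rw [hf, Matrix.vecMul, dotProduct]
      exact Finset.sum_congr rfl fun i _ => congrArg (f i * ·) (hw i)
    rw [Pi.zero_apply]
    rcases lt_trichotomy (j : ℕ) k with hj | hj | hj
    · rw [key (fun i => a i j) fun i => by simp [bordered]; omega,
        det_bordered_column _ _ _ (by omega), det_bordered_column a k j hj,
        det_bordered_column b k j hj]
      ring
    · rw [key (fun i => a i k) fun i => by simp [bordered, hj],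
        det_bordered_column _ _ _ (by omega), det_bordered_next_column a k,
        det_bordered_next_column b k]
      ring
    · rw [key e fun i => by simp [bordered]; omega,
        det_bordered_single_zero, det_bordered_single_zero, det_bordered_eq_sum b]
      simp [e]
      ring
  have hzero := hf v
  rw [Matrix.eq_zero_of_vecMul_eq_zero hdet hker] at hzero
  simp only [Pi.zero_apply, zero_mul, Finset.sum_const_zero] at hzero
  linarith

theorem mom_succ (s t i j : ℕ) : mom (s + 1) t i j = mom s t (i + 1) (j + 1) := by
  simp only [mom, add_assoc, add_comm 1]

/-- the discrete spectral transformation for the adjacent polynomials,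
`Q_n^{s,t} = x·P_{n−1}^{s+1,t} − (ξ_{n−1}^{s,t}τ_n^{s+1,t}/(ξ_n^{s,t}τ_{n−1}^{s+1,t}))·Q_{n−1}^{s,t}`. -/
theorem Q_transformation (s t n : ℕ) (hn : 1 ≤ n)
    (h₁ : xi s t n ≠ 0) (h₂ : xi s t (n - 1) ≠ 0)
    (h₃ : tau (s + 1) t (n - 1) ≠ 0) (h₄ : tau (s + 1) t n ≠ 0) (x : ℝ) :
    Q s t n x =
      x * P (s + 1) t (n - 1) x -
        (xi s t (n - 1) * tau (s + 1) t n / (xi s t n * tau (s + 1) t (n - 1))) *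
          Q s t (n - 1) x := by
  obtain ⟨k, rfl⟩ : ∃ k, n = k + 1 := ⟨n - 1, by omega⟩
  rw [Nat.add_sub_cancel] at *
  let a : ℕ → ℕ → ℝ := fun i j => mom s t i (j + 1)
  have hxi (m : ℕ) : xi s t m = leadingMinor a m := rfl
  have htau (m : ℕ) : tau (s + 1) t m = leadingMinor (fun i j => a (i + 1) j) m := by
    simp only [tau, leadingMinor, a, mom_succ]
  have hQ (m : ℕ) : Q s t m x = 1 / xi s t m * (bordered a m fun i => x ^ i).det := rfl
  have hP : x * P (s + 1) t k x = 1 / tau (s + 1) t k *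
      (bordered (fun i j => a (i + 1) j) k fun i => x ^ (i + 1)).det := by
    have hdet : (bordered (fun i j => a (i + 1) j) k fun i => x ^ (i + 1)).det =
        x * (bordered (fun i j => a (i + 1) j) k fun i => x ^ i).det := by
      rw [det_bordered_eq_sum, det_bordered_eq_sum, Finset.mul_sum]
      exact Finset.sum_congr rfl fun i _ => by ring
    rw [hdet]
    simp only [P, bordered, a, mom_succ]
    ring
  have key := det_bordered_mul_leadingMinor a k (by rwa [← htau]) fun i => x ^ i
  rw [← htau, ← htau, ← hxi] at key
  rw [hQ, hQ, hP]
  field_simp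
  linarith
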